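/- arXiv:2401.00397 — 3 statements merged into one kernel-verified Lean document; each statement's English description precedes it below -/
import Mathlib

section
/- Let A and B be maximally monotone set-valued operators on H, let λ > 0, and suppose the warped resolvents J_{λA}^M and J_{λB}^M exist. Let S = {(x,y) ∈ H × H : M y − M x ∈ λ A x and M x − M y ∈ λ B y}, E = {x ∈ H : (x, −A_λ^M x) ∈ G(B)} and F = {y ∈ H : (y, −B_λ^M y) ∈ G(A)}. Then S = (F × E) ∩ G(J_{λB}^M); that is, (x,y) ∈ S if and only if x ∈ F, y ∈ E and y = J_{λB}^M x. -/
open scoped RealInnerProductSpace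

theorem warped_unique {H : Type*} [NormedAddCommGroup H] [InnerProductSpace ℝ H]
    (M : H →L[ℝ] H) {c : ℝ} (hc : 0 < c) (hM : ∀ z : H, c * ‖z‖ ^ 2 ≤ ⟪M z, z⟫)
    (T : Set (H × H))
    (hT : ∀ p ∈ T, ∀ q ∈ T, (0 : ℝ) ≤ ⟪p.1 - q.1, p.2 - q.2⟫)
    {lam : ℝ} (hlam : 0 < lam) {x y z : H}
    (hy : (y, lam⁻¹ • (M x - M y)) ∈ T) (hz : (z, lam⁻¹ • (M x - M z)) ∈ T) : y = z := by
  have h := hT _ hy _ hz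
  have e : lam⁻¹ • (M x - M y) - lam⁻¹ • (M x - M z) = -(lam⁻¹ • M (y - z)) := by
    rw [map_sub, ← smul_sub, ← smul_neg]
    congr 1
    abel
  simp only at h
  rw [e, inner_neg_right, real_inner_smul_right, real_inner_comm] at h
  have h1 := hM (y - z)
  have hl : 0 < lam⁻¹ := inv_pos.mpr hlam
  have h2 : ⟪M (y - z), y - z⟫ ≤ 0 := by
    by_contra hh
    push Not at hh
    have := mul_pos hl hh
    linarith
  have h3 : ‖y - z‖ ^ 2 ≤ 0 := by
    by_contra hh
    push Not at hh
    have := mul_pos hc hh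
    linarith
  have h4 : ‖y - z‖ = 0 := by
    have := sq_nonneg ‖y - z‖
    exact pow_eq_zero_iff (two_ne_zero) |>.mp (le_antisymm h3 this)
  exact sub_eq_zero.mp (norm_eq_zero.mp h4)

/-- Let `A, B` be maximally monotone, `λ > 0`, `JA = J_{λA}^M`,
`JB = J_{λB}^M`. With `S = {(x,y) : My − Mx ∈ λAx and Mx − My ∈ λBy}`,
`E = {x : (x, −A_λ^M x) ∈ G(B)}` and `F = {y : (y, −B_λ^M y) ∈ G(A)}`, we have
`S = (F × E) ∩ G(JB)`. -/
theorem stmt_13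
    {H : Type*} [NormedAddCommGroup H] [InnerProductSpace ℝ H] [CompleteSpace H]
    (M : H →L[ℝ] H) (hMsa : IsSelfAdjoint M)
    {c : ℝ} (hc : 0 < c) (hM : ∀ z : H, c * ‖z‖ ^ 2 ≤ ⟪M z, z⟫)
    (A B : Set (H × H))
    (hAmono : ∀ p ∈ A, ∀ q ∈ A, (0 : ℝ) ≤ ⟪p.1 - q.1, p.2 - q.2⟫)
    (hAmax : ∀ p : H × H, (∀ q ∈ A, (0 : ℝ) ≤ ⟪p.1 - q.1, p.2 - q.2⟫) → p ∈ A)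
    (hBmono : ∀ p ∈ B, ∀ q ∈ B, (0 : ℝ) ≤ ⟪p.1 - q.1, p.2 - q.2⟫)
    (hBmax : ∀ p : H × H, (∀ q ∈ B, (0 : ℝ) ≤ ⟪p.1 - q.1, p.2 - q.2⟫) → p ∈ B)
    {lam : ℝ} (hlam : 0 < lam)
    (JA : H → H) (hJA : ∀ x : H, (JA x, lam⁻¹ • (M x - M (JA x))) ∈ A)
    (JB : H → H) (hJB : ∀ x : H, (JB x, lam⁻¹ • (M x - M (JB x))) ∈ B)
    (S : Set (H × H))
    (hS : S = {p : H × H |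
      (p.1, lam⁻¹ • (M p.2 - M p.1)) ∈ A ∧ (p.2, lam⁻¹ • (M p.1 - M p.2)) ∈ B})
    (E F : Set H)
    (hE : E = {x : H | (x, -(lam⁻¹ • (M x - M (JA x)))) ∈ B})
    (hF : F = {y : H | (y, -(lam⁻¹ • (M y - M (JB y)))) ∈ A}) :
    S = (F ×ˢ E) ∩ {p : H × H | p.2 = JB p.1} := by
  subst hS hE hF
  ext ⟨x, y⟩
  simp only [Set.mem_setOf_eq, Set.mem_inter_iff, Set.mem_prod, ← smul_neg, neg_sub]
  constructor
  · rintro ⟨hA, hB⟩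
    have h1 : y = JB x := warped_unique M hc hM B hBmono hlam hB (hJB x)
    have h2 : x = JA y := warped_unique M hc hM A hAmono hlam hA (hJA y)
    refine ⟨⟨?_, ?_⟩, h1⟩
    · rw [← h1]; exact hA
    · rw [← h2]; exact hB
  · rintro ⟨⟨hA, -⟩, h⟩
    subst h
    exact ⟨hA, hJB x⟩
end

section
/- Let A and B be maximally monotone set-valued operators on H, let λ > 0, and suppose the warped resolvents J_{λA}^M and J_{λB}^M exist. Let S = {(x,y) ∈ H × H : M y − M x ∈ λ A x and M x − M y ∈ λ B y} and assume S ≠ ∅. Fix x₀ ∈ H and define recursively y_n = J_{λB}^M x_n and x_{n+1} = J_{λA}^M y_n for n ≥ 0. Then there exists (x̄, ȳ) ∈ S such that x_n converges weakly to x̄ and y_n converges weakly to ȳ (i.e. ⟨x_n, w⟩ → ⟨x̄, w⟩ and ⟨y_n, w⟩ → ⟨ȳ, w⟩ for every w ∈ H). -/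
open scoped RealInnerProductSpace
open Filter


theorem aux_weaklim {H : Type*} [NormedAddCommGroup H] [InnerProductSpace ℝ H] [CompleteSpace H]
    (x : ℕ → H) (C : ℝ) (hC : ∀ n, ‖x n‖ ≤ C) (F : Ultrafilter ℕ) :
    ∃ xb : H, ∀ w : H, Tendsto (fun n : ℕ => ⟪x n, w⟫) F (nhds ⟪xb, w⟫) := by
  have hcomp := WeakDual.isCompact_closedBall (𝕜 := ℝ) (E := H) 0 C
  let f : ℕ → WeakDual ℝ H := fun n => StrongDual.toWeakDual (InnerProductSpace.toDual ℝ H (x n))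
  obtain ⟨g, -, hg⟩ := hcomp.ultrafilter_le_nhds (F.map f) (by
    simp only [Ultrafilter.coe_map, le_principal_iff, mem_map]
    refine Filter.univ_mem' fun n => ?_
    simpa [f] using hC n)
  refine ⟨(InnerProductSpace.toDual ℝ H).symm (WeakDual.toStrongDual g), fun w => ?_⟩
  have h2 : Tendsto f F (nhds g) := hg
  have h3 := ((WeakDual.eval_continuous w).tendsto g).comp h2
  rw [InnerProductSpace.toDual_symm_apply]
  exact h3

theorem aux_closed {H : Type*} [NormedAddCommGroup H] [InnerProductSpace ℝ H]
    (A : Set (H × H))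
    (hAmono : ∀ p ∈ A, ∀ q ∈ A, (0 : ℝ) ≤ ⟪p.1 - q.1, p.2 - q.2⟫)
    (hAmax : ∀ p : H × H, (∀ q ∈ A, (0 : ℝ) ≤ ⟪p.1 - q.1, p.2 - q.2⟫) → p ∈ A)
    (F : Filter ℕ) [F.NeBot] (u v : ℕ → H) (ub vb : H) (C : ℝ) (hC : ∀ n, ‖u n‖ ≤ C)
    (huv : ∀ n, (u n, v n) ∈ A)
    (hu : ∀ w : H, Tendsto (fun n : ℕ => ⟪u n, w⟫) F (nhds ⟪ub, w⟫))
    (hv : Tendsto v F (nhds vb)) : (ub, vb) ∈ A := by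
  refine hAmax _ fun q hq => ?_
  have h1 : Tendsto (fun n => ⟪u n - q.1, v n - vb⟫) F (nhds 0) := by
    have h0 : Tendsto (fun n => (C + ‖q.1‖) * ‖v n - vb‖) F (nhds 0) := by
      have := (tendsto_iff_norm_sub_tendsto_zero.1 hv).const_mul (C + ‖q.1‖)
      simpa using this
    refine squeeze_zero_norm (fun n => ?_) h0
    refine (norm_inner_le_norm _ _).trans ?_
    gcongr
    exact (norm_sub_le _ _).trans (by have := hC n; gcongr)
  have h2 : Tendsto (fun n => ⟪u n - q.1, vb - q.2⟫) F (nhds ⟪ub - q.1, vb - q.2⟫) := by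
    simp only [inner_sub_left _ q.1]
    exact (hu _).sub_const _
  have h3 := h1.add h2
  rw [zero_add] at h3
  refine ge_of_tendsto' h3 fun n => ?_
  have h4 := hAmono _ (huv n) q hq
  rw [← inner_add_right]
  simpa using h4

theorem aux_step {H : Type*} [NormedAddCommGroup H] [InnerProductSpace ℝ H]
    (M : H →L[ℝ] H) (hs : ∀ u v : H, ⟪M u, v⟫ = ⟪M v, u⟫)
    (A : Set (H × H))
    (hAmono : ∀ p ∈ A, ∀ q ∈ A, (0 : ℝ) ≤ ⟪p.1 - q.1, p.2 - q.2⟫)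
    {lam : ℝ} (hlam : 0 < lam) (p a p' a' : H)
    (h : (p, lam⁻¹ • (M a - M p)) ∈ A) (h' : (p', lam⁻¹ • (M a' - M p')) ∈ A) :
    ⟪M (p - p'), p - p'⟫ + ⟪M ((a - p) - (a' - p')), (a - p) - (a' - p')⟫
      ≤ ⟪M (a - a'), a - a'⟫ := by
  have h1 := hAmono _ h _ h'
  simp only [← smul_sub, inner_smul_right] at h1
  have h2 := nonneg_of_mul_nonneg_right h1 (inv_pos.2 hlam)
  have e : M a - M p - (M a' - M p') = M ((a - p) - (a' - p')) := by simp
  rw [e, real_inner_comm] at h2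
  have e2 : a - a' = (p - p') + ((a - p) - (a' - p')) := by abel
  generalize (a - p) - (a' - p') = z at *
  generalize p - p' = w at *
  rw [e2, map_add, inner_add_left, inner_add_right, inner_add_right, hs w z]
  linarith

/-- Let `A, B` be maximally monotone, `λ > 0`, with warped resolvents
`JA = J_{λA}^M`, `JB = J_{λB}^M`, and let the solution set
`S = {(x,y) : My − Mx ∈ λAx and Mx − My ∈ λBy}` be nonempty. Given `x₀`, define
`y_n = JB x_n`, `x_{n+1} = JA y_n`. Then there is `(x̄,ȳ) ∈ S` with `x_n ⇀ x̄` and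
`y_n ⇀ ȳ` weakly. -/
theorem stmt_16
    {H : Type*} [NormedAddCommGroup H] [InnerProductSpace ℝ H] [CompleteSpace H]
    (M : H →L[ℝ] H) (hMsa : IsSelfAdjoint M)
    {c : ℝ} (hc : 0 < c) (hM : ∀ z : H, c * ‖z‖ ^ 2 ≤ ⟪M z, z⟫)
    (A B : Set (H × H))
    (hAmono : ∀ p ∈ A, ∀ q ∈ A, (0 : ℝ) ≤ ⟪p.1 - q.1, p.2 - q.2⟫)
    (hAmax : ∀ p : H × H, (∀ q ∈ A, (0 : ℝ) ≤ ⟪p.1 - q.1, p.2 - q.2⟫) → p ∈ A)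
    (hBmono : ∀ p ∈ B, ∀ q ∈ B, (0 : ℝ) ≤ ⟪p.1 - q.1, p.2 - q.2⟫)
    (hBmax : ∀ p : H × H, (∀ q ∈ B, (0 : ℝ) ≤ ⟪p.1 - q.1, p.2 - q.2⟫) → p ∈ B)
    {lam : ℝ} (hlam : 0 < lam)
    (JA : H → H) (hJA : ∀ x : H, (JA x, lam⁻¹ • (M x - M (JA x))) ∈ A)
    (JB : H → H) (hJB : ∀ x : H, (JB x, lam⁻¹ • (M x - M (JB x))) ∈ B)
    (S : Set (H × H))
    (hS : S = {p : H × H |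
      (p.1, lam⁻¹ • (M p.2 - M p.1)) ∈ A ∧ (p.2, lam⁻¹ • (M p.1 - M p.2)) ∈ B})
    (hSne : S.Nonempty)
    (x y : ℕ → H) (hy : ∀ n, y n = JB (x n)) (hx : ∀ n, x (n + 1) = JA (y n)) :
    ∃ xb yb : H, (xb, yb) ∈ S ∧
      (∀ w : H, Tendsto (fun n : ℕ => ⟪x n, w⟫) atTop (nhds ⟪xb, w⟫)) ∧
      (∀ w : H, Tendsto (fun n : ℕ => ⟪y n, w⟫) atTop (nhds ⟪yb, w⟫)) := by
  have hs : ∀ u v : H, ⟪M u, v⟫ = ⟪M v, u⟫ := fun u v => by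
    rw [real_inner_comm u (M v)]
    exact (ContinuousLinearMap.isSelfAdjoint_iff_isSymmetric.1 hMsa) u v
  have hN : ∀ z : H, 0 ≤ ⟪M z, z⟫ := fun z => le_trans (by positivity) (hM z)
  have hB' : ∀ n, (y n, lam⁻¹ • (M (x n) - M (y n))) ∈ B := fun n => by
    rw [hy]; exact hJB _
  have hA' : ∀ n, (x (n+1), lam⁻¹ • (M (y n) - M (x (n+1)))) ∈ A := fun n => by
    rw [hx]; exact hJA _
  -- quadratic form tending to zero forces norm convergence
  have hzero : ∀ z : ℕ → H, Tendsto (fun n => ⟪M (z n), z n⟫) atTop (nhds 0) →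
      Tendsto z atTop (nhds 0) := by
    intro z hz
    rw [tendsto_zero_iff_norm_tendsto_zero]
    have h1 : Tendsto (fun n => ‖z n‖ ^ 2) atTop (nhds 0) := by
      refine squeeze_zero (fun n => by positivity) (fun n => ?_)
        (by simpa using hz.const_mul c⁻¹)
      rw [← div_eq_inv_mul, le_div_iff₀ hc, mul_comm]
      exact hM _
    have h2 := h1.sqrt
    simpa using h2
  -- Fejer
  have fejB : ∀ p ∈ S, ∀ n, ⟪M (y n - p.2), y n - p.2⟫ +
      ⟪M ((x n - y n) - (p.1 - p.2)), (x n - y n) - (p.1 - p.2)⟫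
        ≤ ⟪M (x n - p.1), x n - p.1⟫ := by
    intro p hp n
    rw [hS] at hp
    exact aux_step M hs B hBmono hlam _ _ _ _ (hB' n) hp.2
  have fejA : ∀ p ∈ S, ∀ n, ⟪M (x (n+1) - p.1), x (n+1) - p.1⟫ +
      ⟪M ((y n - x (n+1)) - (p.2 - p.1)), (y n - x (n+1)) - (p.2 - p.1)⟫
        ≤ ⟪M (y n - p.2), y n - p.2⟫ := by
    intro p hp n
    rw [hS] at hp
    exact aux_step M hs A hAmono hlam _ _ _ _ (hA' n) hp.1
  have hanti : ∀ p ∈ S, Antitone (fun n => ⟪M (x n - p.1), x n - p.1⟫) := by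
    intro p hp
    refine antitone_nat_of_succ_le fun n => ?_
    have h1 := fejA p hp n
    have h2 := fejB p hp n
    have h3 := hN ((x n - y n) - (p.1 - p.2))
    have h4 := hN ((y n - x (n+1)) - (p.2 - p.1))
    linarith
  have hconv : ∀ p ∈ S, ∃ l, Tendsto (fun n => ⟪M (x n - p.1), x n - p.1⟫) atTop (nhds l) := by
    intro p hp
    exact ⟨_, tendsto_atTop_ciInf (hanti p hp) ⟨0, by rintro _ ⟨n, rfl⟩; exact hN _⟩⟩
  obtain ⟨⟨p, r⟩, hpr⟩ := hSne
  obtain ⟨l, hl⟩ := hconv _ hpr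
  have hdiff : Tendsto (fun n => ⟪M (x n - p), x n - p⟫ - ⟪M (x (n+1) - p), x (n+1) - p⟫)
      atTop (nhds 0) := by
    simpa using hl.sub (hl.comp (tendsto_add_atTop_nat 1))
  have hd1 : Tendsto (fun n => (x n - y n) - (p - r)) atTop (nhds 0) := by
    refine hzero _ (squeeze_zero (fun n => hN _) (fun n => ?_) hdiff)
    have h1 := fejA _ hpr n
    have h2 := fejB _ hpr n
    have h4 := hN ((y n - x (n+1)) - (r - p))
    dsimp only at h1 h2
    linarith
  have hd2 : Tendsto (fun n => (y n - x (n+1)) - (r - p)) atTop (nhds 0) := by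
    refine hzero _ (squeeze_zero (fun n => hN _) (fun n => ?_) hdiff)
    have h1 := fejA _ hpr n
    have h2 := fejB _ hpr n
    have h4 := hN ((x n - y n) - (p - r))
    dsimp only at h1 h2
    linarith
  have hd1' : Tendsto (fun n => x n - y n) atTop (nhds (p - r)) := tendsto_sub_nhds_zero_iff.1 hd1
  have hd2' : Tendsto (fun n => y n - x (n+1)) atTop (nhds (r - p)) :=
    tendsto_sub_nhds_zero_iff.1 hd2
  -- boundedness
  obtain ⟨C, hC⟩ : ∃ C, ∀ n, ‖x n‖ ≤ C := by
    refine ⟨√(c⁻¹ * ⟪M (x 0 - p), x 0 - p⟫) + ‖p‖, fun n => ?_⟩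
    have h1 : ‖x n - p‖ ≤ √(c⁻¹ * ⟪M (x 0 - p), x 0 - p⟫) := by
      apply Real.le_sqrt_of_sq_le
      rw [← div_eq_inv_mul, le_div_iff₀ hc, mul_comm]
      exact (hM _).trans (hanti _ hpr (Nat.zero_le n))
    have h2 := norm_add_le (x n - p) p
    rw [sub_add_cancel] at h2
    linarith
  obtain ⟨D, hD⟩ : ∃ D, ∀ n, ‖y n‖ ≤ D := by
    obtain ⟨K, hK⟩ := hd1'.norm.bddAbove_range
    refine ⟨C + K, fun n => ?_⟩
    have h1 : ‖x n - y n‖ ≤ K := hK ⟨n, rfl⟩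
    have h2 := norm_sub_le (x n) (x n - y n)
    rw [sub_sub_cancel] at h2
    linarith [hC n]
  -- weak limits of y from those of x
  have hyx : ∀ F : Filter ℕ, F ≤ atTop → ∀ xb : H,
      (∀ w : H, Tendsto (fun n : ℕ => ⟪x n, w⟫) F (nhds ⟪xb, w⟫)) →
      (∀ w : H, Tendsto (fun n : ℕ => ⟪y n, w⟫) F (nhds ⟪xb - (p - r), w⟫)) := by
    intro F hF xb h w
    have h1 : Tendsto (fun n => ⟪x n - y n, w⟫) F (nhds ⟪p - r, w⟫) :=
      (hd1'.mono_left hF).inner tendsto_const_nhds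
    have h2 := (h w).sub h1
    simpa only [← inner_sub_left, sub_sub_cancel] using h2
  have hclus : ∀ F : Ultrafilter ℕ, (F : Filter ℕ) ≤ atTop → ∀ xb : H,
      (∀ w : H, Tendsto (fun n : ℕ => ⟪x n, w⟫) F (nhds ⟪xb, w⟫)) →
      (xb, xb - (p - r)) ∈ S := by
    intro F hF xb h
    have hyw := hyx F hF xb h
    have hxw : ∀ w : H, Tendsto (fun n : ℕ => ⟪x (n+1), w⟫) F (nhds ⟪xb, w⟫) := by
      intro w
      have h1 : Tendsto (fun n => ⟪y n - x (n+1), w⟫) F (nhds ⟪r - p, w⟫) :=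
        (hd2'.mono_left hF).inner tendsto_const_nhds
      have h2 := (hyw w).sub h1
      have e : xb - (p - r) - (r - p) = xb := by abel
      simpa only [← inner_sub_left, sub_sub_cancel, e] using h2
    rw [hS]
    constructor
    · refine aux_closed A hAmono hAmax F (fun n => x (n+1)) _ _ _ C (fun n => hC _) hA' hxw ?_
      have h1 := (((M.continuous.tendsto _).comp hd2').const_smul lam⁻¹).mono_left hF
      have e : M (xb - (p - r)) - M xb = M (r - p) := by simp
      simp only [e]
      simpa [Function.comp_def] using h1
    · refine aux_closed B hBmono hBmax F y _ _ _ D hD hB' hyw ?_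
      have h1 := (((M.continuous.tendsto _).comp hd1').const_smul lam⁻¹).mono_left hF
      have e : M xb - M (xb - (p - r)) = M (p - r) := by simp
      simp only [e]
      simpa [Function.comp_def] using h1
  obtain ⟨F₀, hF₀⟩ := Ultrafilter.exists_le (atTop : Filter ℕ)
  obtain ⟨xb, hxb⟩ := aux_weaklim x C hC F₀
  have hxbS := hclus F₀ hF₀ xb hxb
  have hfin : ∀ w : H, Tendsto (fun n : ℕ => ⟪x n, w⟫) atTop (nhds ⟪xb, w⟫) := by
    intro w
    rw [tendsto_iff_ultrafilter]
    intro F hF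
    obtain ⟨xt, hxt⟩ := aux_weaklim x C hC F
    have hxtS := hclus F hF xt hxt
    obtain ⟨l1, hl1⟩ := hconv _ hxbS
    obtain ⟨l2, hl2⟩ := hconv _ hxtS
    have hk : Tendsto (fun n => ⟪x n, M (xb - xt)⟫) atTop
        (nhds ((l2 - l1 + ⟪M xb, xb⟫ - ⟪M xt, xt⟫) / 2)) := by
      have h1 := ((((hl2.sub hl1).add_const ⟪M xb, xb⟫).sub_const ⟪M xt, xt⟫).div_const 2)
      refine h1.congr fun n => ?_
      simp only [map_sub, inner_sub_left, inner_sub_right]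
      rw [hs (x n) xb, hs (x n) xt, real_inner_comm (M xb) (x n), real_inner_comm (M xt) (x n)]
      ring
    have e1 := tendsto_nhds_unique (hxb (M (xb - xt))) (hk.mono_left hF₀)
    have e2 := tendsto_nhds_unique (hxt (M (xb - xt))) (hk.mono_left hF)
    have e3 : ⟪M (xb - xt), xb - xt⟫ = 0 := by
      rw [real_inner_comm, inner_sub_left, e1, e2, sub_self]
    have e4 := hM (xb - xt)
    rw [e3] at e4
    have e5 : ‖xb - xt‖ ^ 2 = 0 := le_antisymm (by
      by_contra hh
      push Not at hh
      have := mul_pos hc hh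
      linarith) (by positivity)
    have e6 : xb = xt := by
      rw [← sub_eq_zero, ← norm_eq_zero]
      exact pow_eq_zero_iff (two_ne_zero) |>.1 e5
    rw [e6]
    exact hxt w
  exact ⟨xb, xb - (p - r), hxbS, hfin, hyx atTop le_rfl xb hfin⟩
end

section
/- Let A and B be maximally monotone set-valued operators on H, let λ > 0, and suppose the warped resolvents J_{λA}^M and J_{λB}^M exist. Let S = {(x,y) ∈ H × H : M y − M x ∈ λ A x and M x − M y ∈ λ B y} and assume S = ∅. Fix x₀ ∈ H and define recursively y_n = J_{λB}^M x_n and x_{n+1} = J_{λA}^M y_n for n ≥ 0. Then ‖x_n‖ → ∞ and ‖y_n‖ → ∞ as n → ∞. -/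
open scoped RealInnerProductSpace
open Filter


theorem aux_expand {H : Type*} [NormedAddCommGroup H] [InnerProductSpace ℝ H]
    (M : H →L[ℝ] H) (hs : ∀ u v : H, ⟪M u, v⟫ = ⟪M v, u⟫) (a b : H) :
    ⟪M (a + b), a + b⟫ = ⟪M a, a⟫ + 2 * ⟪M a, b⟫ + ⟪M b, b⟫ := by
  rw [map_add, inner_add_left, inner_add_right, inner_add_right, hs b a]; ring

theorem aux_upper {H : Type*} [NormedAddCommGroup H] [InnerProductSpace ℝ H]
    (M : H →L[ℝ] H) (a b : H) : ⟪M a, b⟫ ≤ ‖M‖ * ‖a‖ * ‖b‖ := by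
  refine (real_inner_le_norm _ _).trans ?_
  gcongr
  exact M.le_opNorm a

/-- bounded ultrafilter weak limits -/
theorem aux_weak {H : Type*} [NormedAddCommGroup H] [InnerProductSpace ℝ H] [CompleteSpace H]
    (x : ℕ → H) (U : Ultrafilter ℕ) (R : ℝ) (hR : ∀ᶠ n in (U : Filter ℕ), ‖x n‖ ≤ R) :
    ∃ w : H, ∀ h : H, Tendsto (fun n => ⟪x n, h⟫) U (nhds ⟪w, h⟫) := by
  let f : ℕ → WeakDual ℝ H := fun n =>
    StrongDual.toWeakDual (InnerProductSpace.toDual ℝ H (x n))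
  have hc := WeakDual.isCompact_closedBall (𝕜 := ℝ) (E := H) 0 R
  have hmem : ((U.map f : Ultrafilter _) : Filter (WeakDual ℝ H)) ≤
      𝓟 (WeakDual.toStrongDual ⁻¹' Metric.closedBall 0 R) := by
    rw [le_principal_iff]
    change ∀ᶠ n in (U : Filter ℕ), _
    filter_upwards [hR] with n hn
    simpa [f] using hn
  obtain ⟨φ, -, hφ⟩ := hc.ultrafilter_le_nhds _ hmem
  refine ⟨(InnerProductSpace.toDual ℝ H).symm (WeakDual.toStrongDual φ), fun h => ?_⟩
  have h1 : Tendsto f U (nhds φ) := hφ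
  have h2 := ((WeakDual.eval_continuous (𝕜 := ℝ) h).tendsto φ).comp h1
  rw [InnerProductSpace.toDual_symm_apply]
  exact h2

theorem aux_main {H : Type*} [NormedAddCommGroup H] [InnerProductSpace ℝ H] [CompleteSpace H]
    (M : H →L[ℝ] H) (hs : ∀ u v : H, ⟪M u, v⟫ = ⟪M v, u⟫)
    {c : ℝ} (hc : 0 < c) (hM : ∀ z : H, c * ‖z‖ ^ 2 ≤ ⟪M z, z⟫)
    (T : H → H)
    (hT : ∀ u v, ⟪M (T u - T v), T u - T v⟫ +
      1 / 2 * ⟪M ((u - v) - (T u - T v)), (u - v) - (T u - T v)⟫ ≤ ⟪M (u - v), u - v⟫)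
    (hfix : ∀ w, T w ≠ w)
    (x : ℕ → H) (hx : ∀ n, x (n + 1) = T (x n)) :
    Tendsto (fun n : ℕ => ‖x n‖) atTop atTop := by
  have hq0 : ∀ z : H, 0 ≤ ⟪M z, z⟫ := fun z => le_trans (by positivity) (hM z)
  have hne : ∀ u v, ⟪M (T u - T v), T u - T v⟫ ≤ ⟪M (u - v), u - v⟫ := fun u v => by
    have := hT u v
    have := hq0 ((u - v) - (T u - T v))
    linarith
  set d : ℕ → H := fun n => x n - x (n + 1) with hd
  have hdd : ∀ n, ⟪M (d (n+1)), d (n+1)⟫ + 1 / 2 * ⟪M (d n - d (n+1)), d n - d (n+1)⟫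
      ≤ ⟪M (d n), d n⟫ := fun n => by
    have := hT (x n) (x (n+1))
    simpa only [hd, hx] using this
  have hanti : Antitone (fun n => ⟪M (d n), d n⟫) := antitone_nat_of_succ_le fun n => by
    have := hdd n
    have := hq0 (d n - d (n+1))
    linarith
  have hbdd : BddBelow (Set.range (fun n => ⟪M (d n), d n⟫)) :=
    ⟨0, by rintro _ ⟨n, rfl⟩; exact hq0 _⟩
  obtain ⟨L, hL⟩ : ∃ L, Tendsto (fun n => ⟪M (d n), d n⟫) atTop (nhds L) :=
    ⟨_, tendsto_atTop_ciInf hanti hbdd⟩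
  have hL0 : 0 ≤ L := ge_of_tendsto' hL fun n => hq0 _
  have hLle : ∀ n, L ≤ ⟪M (d n), d n⟫ := fun n => hanti.le_of_tendsto hL n
  -- norm convergence from quadratic form convergence
  have hnorm : ∀ (e : ℕ → H) (b : ℕ → ℝ), (∀ n, ⟪M (e n), e n⟫ ≤ b n) →
      Tendsto b atTop (nhds 0) → Tendsto (fun n => ‖e n‖) atTop (nhds 0) := by
    intro e b hb hb0
    have h1 : Tendsto (fun n => ‖e n‖ ^ 2) atTop (nhds 0) := by
      refine squeeze_zero (fun n => by positivity) (g := fun n => b n / c) (fun n => ?_) ?_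
      · rw [le_div_iff₀ hc]; linarith [hM (e n), hb n]
      · simpa using hb0.div_const c
    have h2 := h1.sqrt
    simpa using h2
  rcases hL0.eq_or_lt with hL00 | hLpos
  · -- asymptotically regular case
    rw [← hL00] at hL
    have hd0 := hnorm d _ (fun n => le_rfl) hL
    by_contra hcon
    rw [tendsto_atTop] at hcon
    push Not at hcon
    obtain ⟨R, hR⟩ := hcon
    have hfr : ∃ᶠ n in atTop, ‖x n‖ ≤ R := by
      refine Filter.Frequently.mono hR fun n hn => ?_
      exact le_of_lt (by simpa using hn)
    have : NeBot (atTop ⊓ 𝓟 {n | ‖x n‖ ≤ R}) := frequently_mem_iff_neBot.1 hfr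
    let U := Ultrafilter.of (atTop ⊓ 𝓟 {n | ‖x n‖ ≤ R})
    have hU : (U : Filter ℕ) ≤ atTop ⊓ 𝓟 {n | ‖x n‖ ≤ R} := Ultrafilter.of_le _
    have hUat : (U : Filter ℕ) ≤ atTop := hU.trans inf_le_left
    have hUR : ∀ᶠ n in (U : Filter ℕ), ‖x n‖ ≤ R := le_principal_iff.1 (hU.trans inf_le_right)
    obtain ⟨w, hw⟩ := aux_weak x U R hUR
    have hdU : Tendsto (fun n => ‖d n‖) U (nhds 0) := hd0.mono_left hUat
    apply hfix w
    -- key inequality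
    have key : ∀ n, ⟪M (w - T w), w - T w⟫ ≤
        -2 * ⟪x n - w, M (w - T w)⟫ + 2 * ⟪M (d n), x (n+1) - T w⟫ + ⟪M (d n), d n⟫ := by
      intro n
      have e1 := aux_expand M hs (x n - w) (w - T w)
      have e2 := aux_expand M hs (d n) (x (n+1) - T w)
      have e3 := hne (x n) w
      rw [← hx] at e3
      have e4 : (x n - w) + (w - T w) = d n + (x (n+1) - T w) := by simp only [hd]; abel
      rw [e4] at e1
      rw [hs (x n - w) (w - T w), real_inner_comm (x n - w) (M (w - T w))] at e1
      linarith
    have lim1 : Tendsto (fun n => ⟪x n - w, M (w - T w)⟫) U (nhds 0) := by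
      have := (hw (M (w - T w))).sub_const ⟪w, M (w - T w)⟫
      simpa [inner_sub_left] using this
    have lim2 : Tendsto (fun n => ‖M‖ * ‖d n‖ * (R + ‖d n‖ + ‖T w‖)) U (nhds 0) := by
      have := (hdU.const_mul ‖M‖).mul ((hdU.const_add R).add_const ‖T w‖)
      simpa using this
    have lim3 : Tendsto (fun n => ⟪M (d n), d n⟫) U (nhds 0) := hL.mono_left hUat
    have lim : Tendsto (fun n => -2 * ⟪x n - w, M (w - T w)⟫ +
        2 * (‖M‖ * ‖d n‖ * (R + ‖d n‖ + ‖T w‖)) + ⟪M (d n), d n⟫) U (nhds 0) := by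
      have := ((lim1.const_mul (-2)).add (lim2.const_mul 2)).add lim3
      simpa using this
    have hle : ⟪M (w - T w), w - T w⟫ ≤ 0 := by
      refine ge_of_tendsto lim ?_
      filter_upwards [hUR] with n hn
      have k1 := key n
      have k2 := aux_upper M (d n) (x (n+1) - T w)
      have k3 : ‖x (n+1) - T w‖ ≤ R + ‖d n‖ + ‖T w‖ := by
        have e : x (n+1) - T w = x n - d n - T w := by simp only [hd]; abel
        rw [e]
        have := norm_sub_le (x n - d n) (T w)
        have := norm_sub_le (x n) (d n)
        linarith
      have k4 : ‖M‖ * ‖d n‖ * ‖x (n+1) - T w‖ ≤ ‖M‖ * ‖d n‖ * (R + ‖d n‖ + ‖T w‖) := by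
        gcongr
      linarith
    have h5 : ‖w - T w‖ ^ 2 ≤ 0 := by
      have := hM (w - T w)
      by_contra h
      push Not at h
      nlinarith [mul_pos hc h]
    have h6 : ‖w - T w‖ = 0 := by
      have := sq_nonneg ‖w - T w‖
      exact pow_eq_zero_iff (two_ne_zero) |>.1 (le_antisymm h5 this)
    exact (sub_eq_zero.1 (norm_eq_zero.1 h6)).symm
  · -- linear growth case
    have hdiff : Tendsto (fun n => ‖d n - d (n+1)‖) atTop (nhds 0) := by
      refine hnorm _ (fun n => 2 * (⟪M (d n), d n⟫ - ⟪M (d (n+1)), d (n+1)⟫))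
        (fun n => ?_) ?_
      · have := hdd n
        linarith
      · have := (hL.sub ((tendsto_add_atTop_iff_nat 1).2 hL)).const_mul 2
        simpa using this
    have hdz : Tendsto (fun n => d n - d (n+1)) atTop (nhds 0) :=
      tendsto_zero_iff_norm_tendsto_zero.2 hdiff
    have hdk : ∀ k : ℕ, Tendsto (fun n => d n - d (n+k)) atTop (nhds 0) := by
      intro k
      induction k with
      | zero => simp
      | succ k ih =>
        have := ih.add ((tendsto_add_atTop_iff_nat k).2 hdz)
        simp only [add_zero] at this
        refine this.congr fun n => ?_
        rw [← add_assoc]; abel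
    have hxk : ∀ k : ℕ, Tendsto (fun n => (x n - x (n+k)) - (k:ℝ) • d n) atTop (nhds 0) := by
      intro k
      induction k with
      | zero => simp
      | succ k ih =>
        have := ih.sub (hdk k)
        simp only [sub_zero] at this
        refine this.congr fun n => ?_
        have : d (n+k) = x (n+k) - x (n+(k+1)) := rfl
        rw [this]
        push_cast
        rw [add_smul, one_smul]
        abel
    have hM0 : 0 < ‖M‖ + 1 := by positivity
    have hup : ∀ z, ⟪M z, z⟫ ≤ (‖M‖ + 1) * ‖z‖ ^ 2 := fun z => by
      have := aux_upper M z z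
      nlinarith [sq_nonneg ‖z‖]
    set δ := Real.sqrt (L / (‖M‖ + 1)) with hδ
    have hδ0 : 0 < δ := Real.sqrt_pos.2 (by positivity)
    have hδle : ∀ n, δ ≤ ‖d n‖ := fun n => by
      refine Real.sqrt_le_iff.2 ⟨by positivity, ?_⟩
      rw [div_le_iff₀ hM0]
      linarith [hLle n, hup (d n)]
    have hmono : ∀ k n, ⟪M (x n - x (n+k)), x n - x (n+k)⟫ ≤ ⟪M (x 0 - x k), x 0 - x k⟫ := by
      intro k n
      induction n with
      | zero => simp
      | succ n ih =>
        have := hne (x n) (x (n+k))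
        rw [← hx, ← hx] at this
        rw [show n + 1 + k = n + k + 1 by ring]
        exact this.trans ih
    set r := Real.sqrt (c / (‖M‖ + 1)) with hr
    have hr0 : 0 < r := Real.sqrt_pos.2 (by positivity)
    have hr2 : r ^ 2 * (‖M‖ + 1) = c := by
      rw [hr, Real.sq_sqrt (by positivity)]; field_simp
    have hrle : ∀ k n, r * ‖x n - x (n+k)‖ ≤ ‖x 0 - x k‖ := by
      intro k n
      refine le_of_sq_le_sq ?_ (norm_nonneg _)
      have h1 := hmono k n
      have h2 := hM (x n - x (n+k))
      have h3 := hup (x 0 - x k)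
      rw [← hr2] at h2
      have h4 : (‖M‖ + 1) * (r * ‖x n - x (n+k)‖)^2 ≤ (‖M‖ + 1) * ‖x 0 - x k‖^2 := by
        nlinarith
      exact le_of_mul_le_mul_left h4 hM0
    have hgrow : ∀ k : ℕ, r * (k * δ) ≤ ‖x 0 - x k‖ := by
      intro k
      have l1 : Tendsto (fun n => r * (k * δ - ‖(x n - x (n+k)) - (k:ℝ) • d n‖)) atTop
          (nhds (r * (k * δ))) := by
        have := ((hxk k).norm.const_sub (k * δ)).const_mul r
        simpa using this
      refine le_of_tendsto' l1 fun n => ?_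
      refine le_trans ?_ (hrle k n)
      gcongr
      have h1 : ‖(k:ℝ) • d n‖ = k * ‖d n‖ := by rw [norm_smul]; simp
      have h2 : (k:ℝ) * δ ≤ k * ‖d n‖ := by gcongr; exact hδle n
      have h3 := norm_sub_norm_le ((k:ℝ) • d n) (x n - x (n+k))
      rw [norm_sub_rev ((k:ℝ) • d n)] at h3
      linarith
    have hlin : Tendsto (fun k : ℕ => (k:ℝ) * (r * δ) - ‖x 0‖) atTop atTop :=
      tendsto_atTop_add_const_right _ _
        (tendsto_natCast_atTop_atTop.atTop_mul_const (mul_pos hr0 hδ0))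
    refine tendsto_atTop_mono (fun k => ?_) hlin
    have := hgrow k
    have := norm_sub_le (x 0) (x k)
    linarith

/-- firm nonexpansiveness of warped resolvents -/
theorem aux_firm {H : Type*} [NormedAddCommGroup H] [InnerProductSpace ℝ H]
    (M : H →L[ℝ] H) (hs : ∀ u v : H, ⟪M u, v⟫ = ⟪M v, u⟫)
    (A : Set (H × H))
    (hAmono : ∀ p ∈ A, ∀ q ∈ A, (0 : ℝ) ≤ ⟪p.1 - q.1, p.2 - q.2⟫)
    {lam : ℝ} (hlam : 0 < lam)
    (J : H → H) (hJ : ∀ x : H, (J x, lam⁻¹ • (M x - M (J x))) ∈ A) (u v : H) :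
    ⟪M (J u - J v), J u - J v⟫ + ⟪M ((u - v) - (J u - J v)), (u - v) - (J u - J v)⟫
      ≤ ⟪M (u - v), u - v⟫ := by
  have h := hAmono _ (hJ u) _ (hJ v)
  simp only at h
  rw [← smul_sub, inner_smul_right] at h
  have h1 := nonneg_of_mul_nonneg_right h (inv_pos.2 hlam)
  have e : M u - M (J u) - (M v - M (J v)) = M ((u - v) - (J u - J v)) := by
    simp only [map_sub]; abel
  rw [e, real_inner_comm] at h1
  have e2 := aux_expand M hs ((u - v) - (J u - J v)) (J u - J v)
  rw [sub_add_cancel] at e2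
  linarith

/-- Let `A, B` be maximally monotone, `λ > 0`, with warped resolvents
`JA = J_{λA}^M`, `JB = J_{λB}^M`, and suppose the solution set
`S = {(x,y) : My − Mx ∈ λAx and Mx − My ∈ λBy}` is empty. Given `x₀`, define
`y_n = JB x_n`, `x_{n+1} = JA y_n`. Then `‖x_n‖ → ∞` and `‖y_n‖ → ∞`. -/
theorem stmt_18
    {H : Type*} [NormedAddCommGroup H] [InnerProductSpace ℝ H] [CompleteSpace H]
    (M : H →L[ℝ] H) (hMsa : IsSelfAdjoint M)
    {c : ℝ} (hc : 0 < c) (hM : ∀ z : H, c * ‖z‖ ^ 2 ≤ ⟪M z, z⟫)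
    (A B : Set (H × H))
    (hAmono : ∀ p ∈ A, ∀ q ∈ A, (0 : ℝ) ≤ ⟪p.1 - q.1, p.2 - q.2⟫)
    (hAmax : ∀ p : H × H, (∀ q ∈ A, (0 : ℝ) ≤ ⟪p.1 - q.1, p.2 - q.2⟫) → p ∈ A)
    (hBmono : ∀ p ∈ B, ∀ q ∈ B, (0 : ℝ) ≤ ⟪p.1 - q.1, p.2 - q.2⟫)
    (hBmax : ∀ p : H × H, (∀ q ∈ B, (0 : ℝ) ≤ ⟪p.1 - q.1, p.2 - q.2⟫) → p ∈ B)
    {lam : ℝ} (hlam : 0 < lam)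
    (JA : H → H) (hJA : ∀ x : H, (JA x, lam⁻¹ • (M x - M (JA x))) ∈ A)
    (JB : H → H) (hJB : ∀ x : H, (JB x, lam⁻¹ • (M x - M (JB x))) ∈ B)
    (hSempty : {p : H × H |
      (p.1, lam⁻¹ • (M p.2 - M p.1)) ∈ A ∧ (p.2, lam⁻¹ • (M p.1 - M p.2)) ∈ B} = ∅)
    (x y : ℕ → H) (hy : ∀ n, y n = JB (x n)) (hx : ∀ n, x (n + 1) = JA (y n)) :
    Tendsto (fun n : ℕ => ‖x n‖) atTop atTop ∧
      Tendsto (fun n : ℕ => ‖y n‖) atTop atTop := by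
  have hs : ∀ u v : H, ⟪M u, v⟫ = ⟪M v, u⟫ := fun u v => by
    have := hMsa.isSymmetric u v
    simp only [ContinuousLinearMap.coe_coe] at this
    rw [this, real_inner_comm]
  have hq0 : ∀ z : H, 0 ≤ ⟪M z, z⟫ := fun z => le_trans (by positivity) (hM z)
  have fA := aux_firm M hs A hAmono hlam JA hJA
  have fB := aux_firm M hs B hBmono hlam JB hJB
  have hX : Tendsto (fun n : ℕ => ‖x n‖) atTop atTop := by
    refine aux_main M hs hc hM (fun z => JA (JB z)) (fun u v => ?_) (fun w hw => ?_) x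
      (fun n => by rw [hx, hy])
    · have h1 := fA (JB u) (JB v)
      have h2 := fB u v
      set t := JA (JB u) - JA (JB v)
      set b := JB u - JB v
      have e1 := aux_expand M hs (u - v - b) (b - t)
      have e2 := aux_expand M hs (u - v - b) (-(b - t))
      have e3 := hq0 (u - v - b + -(b - t))
      rw [sub_add_sub_cancel] at e1
      simp only [map_neg, inner_neg_left, inner_neg_right, neg_neg] at e2
      linarith
    · have : (w, JB w) ∈ {p : H × H |
        (p.1, lam⁻¹ • (M p.2 - M p.1)) ∈ A ∧ (p.2, lam⁻¹ • (M p.1 - M p.2)) ∈ B} := by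
        refine ⟨?_, hJB w⟩
        have := hJA (JB w)
        rwa [hw] at this
      rw [hSempty] at this
      exact this
  refine ⟨hX, ?_⟩
  set K := Real.sqrt ((‖M‖ + 1) / c) with hK
  have hK0 : 0 < K := Real.sqrt_pos.2 (by positivity)
  have hK2 : K ^ 2 * c = ‖M‖ + 1 := by
    rw [hK, Real.sq_sqrt (by positivity)]; field_simp
  have hlip : ∀ n, ‖x (n+1)‖ ≤ K * ‖y n‖ + ‖JA 0‖ := by
    intro n
    have h1 := fA (y n) 0
    have h2 := hq0 ((y n - 0) - (JA (y n) - JA 0))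
    have h3 := hM (JA (y n) - JA 0)
    have h4 := aux_upper M (y n - 0) (y n - 0)
    rw [← hx] at h1 h2 h3
    rw [sub_zero] at *
    have h5 : ‖x (n+1) - JA 0‖ ≤ K * ‖y n‖ := by
      refine le_of_sq_le_sq ?_ (by positivity)
      refine le_of_mul_le_mul_left ?_ hc
      have : c * (K * ‖y n‖)^2 = (‖M‖ + 1) * ‖y n‖^2 := by rw [← hK2]; ring
      rw [this]
      nlinarith [sq_nonneg ‖y n‖]
    have := norm_sub_norm_le (x (n+1)) (JA 0)
    linarith
  have h1 : Tendsto (fun n => (‖x (n+1)‖ + -‖JA 0‖) / K) atTop atTop :=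
    (tendsto_atTop_add_const_right _ _ ((tendsto_add_atTop_iff_nat 1).2 hX)).atTop_div_const hK0
  refine tendsto_atTop_mono (fun n => ?_) h1
  rw [div_le_iff₀ hK0]
  linarith [hlip n]
end
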